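/- arXiv:1501.05046 — 4 statements merged into one kernel-verified Lean document; each statement's English description precedes it below -/
import Mathlib

section
/- Let Γ be a vertex-primitive digraph on a finite set Ω with Γ ≠ ∅ and Γ ≠ Ω × Ω, let n = |Ω|, and let d be the (common) valency of Γ. Let κ be the smallest positive integer i such that Γ_i ≠ ∅ (such i exists). Then either (1) Γ_0 ∪ Γ_κ = Ω × Ω and (n − 1)(d − κ) = d(d − 1), or (2) there exists i with κ ≤ i ≤ d − 1 such that Γ_i ≠ ∅ and every vertex v satisfies 1 ≤ |Γ_i(v)| ≤ κ² + κ. -/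
/-- The neighbourhood of a vertex `v` in a digraph `Γ ⊆ Ω × Ω`. -/
def nbhd {Ω : Type*} (Γ : Set (Ω × Ω)) (v : Ω) : Set Ω := {u | (v, u) ∈ Γ}

/-- The automorphism group of a digraph `Γ`, as a subgroup of `Equiv.Perm Ω`. -/
def digraphAut {Ω : Type*} (Γ : Set (Ω × Ω)) : Subgroup (Equiv.Perm Ω) where
  carrier := {g | ∀ u v : Ω, (u, v) ∈ Γ ↔ (g u, g v) ∈ Γ}
  one_mem' := fun _ _ => Iff.rfl
  mul_mem' := fun ha hb u v => (hb u v).trans (ha _ _)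
  inv_mem' := by
    intro a ha u v
    simpa using (ha (a⁻¹ u) (a⁻¹ v)).symm

/-- A permutation group `G ≤ Sym(Ω)` is primitive if it is transitive and
every block is trivial (a subsingleton or the whole set). -/
def IsPrimitiveSubgroup {Ω : Type*} (G : Subgroup (Equiv.Perm Ω)) : Prop :=
  MulAction.IsPretransitive G Ω ∧
    ∀ B : Set Ω, MulAction.IsBlock G B → B.Subsingleton ∨ B = Set.univ

/-- A digraph is vertex-primitive if its automorphism group is primitive. -/
def VertexPrimitive {Ω : Type*} (Γ : Set (Ω × Ω)) : Prop :=
  IsPrimitiveSubgroup (digraphAut Γ)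

/-- `Γ_i`: the pairs of vertices whose neighbourhoods meet in exactly `d - i` points. -/
def GammaI {Ω : Type*} (Γ : Set (Ω × Ω)) (d i : ℕ) : Set (Ω × Ω) :=
  {p | (nbhd Γ p.1 ∩ nbhd Γ p.2).ncard + i = d}

/-- An equivalence relation invariant under a primitive permutation group is trivial or total. -/
theorem IsPrimitiveSubgroup.eq_or_forall {Ω : Type*} {G : Subgroup (Equiv.Perm Ω)}
    (hG : IsPrimitiveSubgroup G) (r : Setoid Ω)
    (hr : ∀ g ∈ G, ∀ a b, r a b → r (g a) (g b)) :
    (∀ a b, r a b → a = b) ∨ ∀ a b, r a b := by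
  by_cases h : ∀ a b, r a b → a = b
  · exact Or.inl h
  push Not at h
  obtain ⟨a, b, hab, hne⟩ := h
  right
  have hblock : MulAction.IsBlock G {u | r a u} := by
    rw [MulAction.isBlock_iff_smul_eq_of_mem]
    intro g x hx hgx
    have hga : r a (g.1 a) := r.trans hgx (r.symm (hr g.1 g.2 _ _ hx))
    ext y
    rw [Set.mem_smul_set_iff_inv_smul_mem]
    constructor
    · intro hy
      have := hr g.1 g.2 _ _ hy
      have e : g.1 (g⁻¹ • y) = y := smul_inv_smul g y
      rw [e] at this
      exact r.trans hga this
    · intro hy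
      have := hr _ (g⁻¹).2 _ _ (r.trans (r.symm hga) hy)
      have e : (g⁻¹).1 (g.1 a) = a := inv_smul_smul g a
      rw [e] at this
      exact this
  rcases hG.2 _ hblock with h | h
  · exact absurd (h (r.refl a) hab) hne
  · intro x y
    have hx : x ∈ {u | r a u} := h ▸ Set.mem_univ x
    have hy : y ∈ {u | r a u} := h ▸ Set.mem_univ y
    exact r.trans (r.symm hx) hy

theorem mem_nbhd {Ω : Type*} {Γ : Set (Ω × Ω)} {v u : Ω} : u ∈ nbhd Γ v ↔ (v, u) ∈ Γ :=
  Iff.rfl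

/-- The number of neighbours of `v` that are not neighbours of `u`. -/
noncomputable def nbhdDist {Ω : Type*} (Γ : Set (Ω × Ω)) (v u : Ω) : ℕ :=
  (nbhd Γ v \ nbhd Γ u).ncard

section Digraph

variable {Ω : Type*} {Γ : Set (Ω × Ω)}

theorem nbhdDist_self (v : Ω) : nbhdDist Γ v v = 0 := by
  simp [nbhdDist]

theorem image_nbhd_of_mem_digraphAut {g : Equiv.Perm Ω} (hg : g ∈ digraphAut Γ) (v : Ω) :
    g '' nbhd Γ v = nbhd Γ (g v) := by
  ext x
  constructor
  · rintro ⟨y, hy, rfl⟩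
    exact (hg v y).1 hy
  · intro hx
    refine ⟨g.symm x, (hg v _).2 ?_, by simp⟩
    simpa using mem_nbhd.1 hx

theorem nbhdDist_of_mem_digraphAut {g : Equiv.Perm Ω} (hg : g ∈ digraphAut Γ) (v u : Ω) :
    nbhdDist Γ (g v) (g u) = nbhdDist Γ v u := by
  rw [nbhdDist, ← image_nbhd_of_mem_digraphAut hg, ← image_nbhd_of_mem_digraphAut hg,
    ← Set.image_sdiff g.injective, Set.ncard_image_of_injective _ g.injective, nbhdDist]

theorem VertexPrimitive.exists_apply_eq (hprim : VertexPrimitive Γ) (v w : Ω) :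
    ∃ g ∈ digraphAut Γ, g v = w := by
  obtain ⟨g, hg⟩ := hprim.1.exists_smul_eq v w
  exact ⟨g.1, g.2, hg⟩

variable [Fintype Ω] {d : ℕ}

theorem ncard_inter_add_nbhdDist (hreg : ∀ v : Ω, (nbhd Γ v).ncard = d) (v u : Ω) :
    (nbhd Γ v ∩ nbhd Γ u).ncard + nbhdDist Γ v u = d := by
  rw [nbhdDist, Set.ncard_inter_add_ncard_sdiff_eq_ncard, hreg]

theorem mem_GammaI_iff (hreg : ∀ v : Ω, (nbhd Γ v).ncard = d) {i : ℕ} {v u : Ω} :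
    (v, u) ∈ GammaI Γ d i ↔ nbhdDist Γ v u = i := by
  have := ncard_inter_add_nbhdDist hreg v u
  simp only [GammaI, Set.mem_ofPred_eq]
  omega

theorem nbhdDist_comm (hreg : ∀ v : Ω, (nbhd Γ v).ncard = d) (v u : Ω) :
    nbhdDist Γ v u = nbhdDist Γ u v := by
  have h1 := ncard_inter_add_nbhdDist hreg v u
  have h2 := ncard_inter_add_nbhdDist hreg u v
  rw [Set.inter_comm] at h2
  omega

theorem nbhdDist_triangle (v u w : Ω) :
    nbhdDist Γ v w ≤ nbhdDist Γ v u + nbhdDist Γ u w := by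
  refine le_trans (Set.ncard_le_ncard ?_ (Set.toFinite _)) (Set.ncard_union_le _ _)
  rintro x ⟨h1, h2⟩
  by_cases h : x ∈ nbhd Γ u
  · exact Or.inr ⟨h, h2⟩
  · exact Or.inl ⟨h1, h⟩

theorem nbhdDist_add_le_card (hreg : ∀ v : Ω, (nbhd Γ v).ncard = d) (v u : Ω) :
    nbhdDist Γ v u + d ≤ Fintype.card Ω := by
  rw [← hreg u, nbhdDist, ← Set.ncard_union_eq Set.disjoint_sdiff_left (Set.toFinite _)
    (Set.toFinite _), ← Nat.card_eq_fintype_card]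
  exact Set.ncard_le_card _

theorem nbhd_eq_of_nbhdDist_eq_zero (hreg : ∀ v : Ω, (nbhd Γ v).ncard = d) {v u : Ω}
    (h : nbhdDist Γ v u = 0) : nbhd Γ v = nbhd Γ u := by
  rw [nbhdDist, Set.ncard_eq_zero (Set.toFinite _), Set.sdiff_eq_empty] at h
  exact Set.eq_of_subset_of_ncard_le h (by rw [hreg, hreg]) (Set.toFinite _)

open Classical in
/-- In a vertex-primitive digraph every in-valency equals the out-valency. -/
theorem VertexPrimitive.card_inNeighbours (hprim : VertexPrimitive Γ)
    (hreg : ∀ v : Ω, (nbhd Γ v).ncard = d) (x : Ω) :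
    (Finset.univ.filter fun u => (u, x) ∈ Γ).card = d := by
  have hconst : ∀ y, (Finset.univ.filter fun u => (u, y) ∈ Γ).card =
      (Finset.univ.filter fun u => (u, x) ∈ Γ).card := by
    intro y
    obtain ⟨g, hg, rfl⟩ := hprim.exists_apply_eq x y
    symm
    refine Finset.card_bij (fun a _ => g a) ?_ (fun _ _ _ _ h => g.injective h) ?_
    · intro a ha
      simpa using (hg a x).1 (by simpa using ha)
    · intro b hb
      refine ⟨g.symm b, ?_, by simp⟩
      simp only [Finset.mem_filter, Finset.mem_univ, true_and] at hb ⊢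
      exact (hg _ _).2 (by simpa using hb)
  have hout : ∀ v, (Finset.univ.filter fun u => (v, u) ∈ Γ).card = d := by
    intro v
    rw [← hreg v, Set.ncard_eq_toFinset_card']
    congr 1
    ext; simp [mem_nbhd]
  have h := Finset.sum_card_bipartiteAbove_eq_sum_card_bipartiteBelow
    (s := (Finset.univ : Finset Ω)) (t := (Finset.univ : Finset Ω)) (fun v u => (v, u) ∈ Γ)
  simp only [Finset.bipartiteAbove, Finset.bipartiteBelow, hout, hconst, Finset.sum_const,
    smul_eq_mul] at h
  exact (Nat.eq_of_mul_eq_mul_left (Finset.card_pos.2 ⟨x, Finset.mem_univ x⟩) h).symm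

open Classical in
theorem VertexPrimitive.sum_ncard_inter (hprim : VertexPrimitive Γ)
    (hreg : ∀ v : Ω, (nbhd Γ v).ncard = d) (v : Ω) :
    ∑ u, (nbhd Γ v ∩ nbhd Γ u).ncard = d * d := by
  have h := Finset.sum_card_bipartiteAbove_eq_sum_card_bipartiteBelow
    (s := (Finset.univ : Finset Ω)) (t := (nbhd Γ v).toFinset) (fun u x => (u, x) ∈ Γ)
  simp only [Finset.bipartiteAbove, Finset.bipartiteBelow, hprim.card_inNeighbours hreg,
    Finset.sum_const, smul_eq_mul] at h
  rw [← Set.ncard_eq_toFinset_card', hreg] at h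
  rw [← h]
  refine Finset.sum_congr rfl fun u _ => ?_
  rw [Set.ncard_eq_toFinset_card']
  congr 1
  ext; simp [mem_nbhd]

theorem VertexPrimitive.sum_nbhdDist (hprim : VertexPrimitive Γ)
    (hreg : ∀ v : Ω, (nbhd Γ v).ncard = d) (v : Ω) :
    ∑ u, nbhdDist Γ v u + d * d = Fintype.card Ω * d := by
  rw [← hprim.sum_ncard_inter hreg v, ← Finset.sum_add_distrib]
  simp only [add_comm (nbhdDist Γ v _), ncard_inter_add_nbhdDist hreg, Finset.sum_const,
    Finset.card_univ, smul_eq_mul]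

/-- In a nontrivial vertex-primitive digraph distinct vertices have distinct neighbourhoods. -/
theorem VertexPrimitive.nbhdDist_pos (hprim : VertexPrimitive Γ) (hne : Γ ≠ ∅)
    (hreg : ∀ v : Ω, (nbhd Γ v).ncard = d) (hd : d < Fintype.card Ω) {v u : Ω} (hvu : v ≠ u) :
    0 < nbhdDist Γ v u := by
  classical
  by_contra! h0
  rcases hprim.eq_or_forall (Setoid.ker (nbhd Γ)) (fun g hg a b hab => by
    rw [Setoid.ker_def] at hab ⊢
    rw [← image_nbhd_of_mem_digraphAut hg, ← image_nbhd_of_mem_digraphAut hg, hab]) with h | h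
  · exact hvu (h v u (nbhd_eq_of_nbhdDist_eq_zero hreg (Nat.le_zero.1 h0)))
  · obtain ⟨⟨a, x⟩, hax⟩ := Set.nonempty_iff_ne_empty.2 hne
    have hall : ∀ b, (b, x) ∈ Γ := fun b => by
      have : nbhd Γ a = nbhd Γ b := h a b
      rwa [← mem_nbhd, ← this, mem_nbhd]
    have := hprim.card_inNeighbours hreg x
    simp only [hall, Finset.filter_true, Finset.card_univ] at this
    omega

/-- The values of `nbhdDist Γ v` leave no gap longer than a positive value `κ` of `nbhdDist Γ`. -/
theorem VertexPrimitive.exists_nbhdDist_mem_Ioc (hprim : VertexPrimitive Γ)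
    (hreg : ∀ v : Ω, (nbhd Γ v).ncard = d) {κ : ℕ} (hκpos : 0 < κ) {a b : Ω}
    (hab : nbhdDist Γ a b = κ) {v w : Ω} {t : ℕ} (ht : t < nbhdDist Γ v w) :
    ∃ u, t < nbhdDist Γ v u ∧ nbhdDist Γ v u ≤ t + κ := by
  by_contra! hgap
  let R : Ω → Ω → Prop := fun x y => nbhdDist Γ x y = κ
  have hmono : ∀ g ∈ digraphAut Γ, ∀ x y,
      Relation.EqvGen.setoid R x y → Relation.EqvGen.setoid R (g x) (g y) := by
    intro g hg x y hxy
    induction hxy with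
    | rel x y h => exact .rel _ _ ((nbhdDist_of_mem_digraphAut hg x y).trans h)
    | refl x => exact .refl _
    | symm x y _ ih => exact .symm _ _ ih
    | trans x y z _ _ ih ih' => exact .trans _ _ _ ih ih'
  have hall : ∀ x y, Relation.EqvGen R x y := by
    rcases hprim.eq_or_forall _ hmono with h | h
    · have := h a b (.rel _ _ hab)
      rw [this, nbhdDist_self] at hab
      omega
    · exact h
  have hinv : ∀ x y, Relation.EqvGen R x y → (nbhdDist Γ v x ≤ t ↔ nbhdDist Γ v y ≤ t) := by
    intro x y hxy
    induction hxy with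
    | rel x y h =>
      have hxy : nbhdDist Γ x y = κ := h
      have h1 := nbhdDist_triangle (Γ := Γ) v x y
      have h2 := nbhdDist_triangle (Γ := Γ) v y x
      rw [nbhdDist_comm hreg y x] at h2
      have h3 := hgap x
      have h4 := hgap y
      constructor <;> intro <;> by_contra! <;> [have := h4 this; have := h3 this] <;> omega
    | refl x => exact Iff.rfl
    | symm x y _ ih => exact ih.symm
    | trans x y z _ _ ih ih' => exact ih.trans ih'
  have := (hinv v w (hall v w)).1 (by simp [nbhdDist_self])
  omega

end Digraph

/-- If the values of `f` leave no gap longer than `κ` up to `s * κ`, and every value in `(0, e)`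
is attained more than `c` times, then `∑ (e - f u)` is large. -/
theorem le_sum_sub_of_gaps {Ω : Type*} [Fintype Ω] (f : Ω → ℕ) (v : Ω) {e κ c : ℕ}
    (hv : f v = 0) (hle : ∀ u, f u ≤ e)
    (hmany : ∀ u, 0 < f u → f u < e → c < (Finset.univ.filter fun w => f w = f u).card)
    (s : ℕ) (hgap : ∀ j < s, ∃ u, j * κ < f u ∧ f u ≤ j * κ + κ) :
    2 * (e : ℤ) + (c + 1) * (2 * s * e - κ * s * (s + 1)) ≤
      2 * ∑ u with f u ≤ s * κ, ((e : ℤ) - f u) := by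
  classical
  have hnn : ∀ u, (0 : ℤ) ≤ (e : ℤ) - f u := fun u => by have := hle u; omega
  induction s with
  | zero =>
    have := Finset.single_le_sum (s := Finset.univ.filter fun u => f u ≤ 0 * κ)
      (f := fun u => (e : ℤ) - f u) (fun u _ => hnn u) (a := v) (by simp [hv])
    simp only [hv] at this
    push_cast at this ⊢
    linarith
  | succ s ih =>
    have ih := ih fun j hj => hgap j (by omega)
    obtain ⟨x, hx1, hx2⟩ := hgap s (by omega)
    have hsplit : (Finset.univ.filter fun u => f u ≤ s * κ) ∪
        (Finset.univ.filter fun u => f u = f x) ⊆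
        Finset.univ.filter fun u => f u ≤ (s + 1) * κ := by
      intro u hu
      simp only [Finset.mem_union, Finset.mem_filter, Finset.mem_univ, true_and] at hu ⊢
      rw [add_mul, one_mul]
      omega
    have hdisj : Disjoint (Finset.univ.filter fun u => f u ≤ s * κ)
        (Finset.univ.filter fun u => f u = f x) := by
      rw [Finset.disjoint_left]
      intro u hu hu'
      simp only [Finset.mem_filter, Finset.mem_univ, true_and] at hu hu'
      omega
    have hsum := Finset.sum_le_sum_of_subset_of_nonneg (f := fun u => (e : ℤ) - f u) hsplit
      (fun u _ _ => hnn u)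
    rw [Finset.sum_union hdisj] at hsum
    have hconst : ∑ u with f u = f x, ((e : ℤ) - f u) =
        (Finset.univ.filter fun u => f u = f x).card * ((e : ℤ) - f x) := by
      rw [Finset.sum_congr rfl (g := fun _ => (e : ℤ) - f x), Finset.sum_const, nsmul_eq_mul]
      intro u hu
      rw [(Finset.mem_filter.1 hu).2]
    have hclass : ((c : ℤ) + 1) * (e - (s + 1) * κ) ≤
        (Finset.univ.filter fun u => f u = f x).card * ((e : ℤ) - f x) := by
      have hx2' : (f x : ℤ) ≤ s * κ + κ := by exact_mod_cast hx2
      rcases (hle x).lt_or_eq with hlt | heq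
      · have h1 : ((c : ℤ) + 1) ≤ (Finset.univ.filter fun u => f u = f x).card := by
          exact_mod_cast hmany x (by omega) hlt
        calc ((c : ℤ) + 1) * (e - (s + 1) * κ) ≤ (c + 1) * (e - f x) := by
              gcongr; linarith
          _ ≤ _ := mul_le_mul_of_nonneg_right h1 (hnn x)
      · rw [heq] at hx2' ⊢
        rw [sub_self, mul_zero]
        exact mul_nonpos_of_nonneg_of_nonpos (by positivity) (by linarith)
    push_cast at *
    nlinarith

theorem sq_lt_of_le_sq_add_one {e κ : ℤ} (h1 : κ < e) (h2 : e ≤ κ ^ 2 + 1) :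
    2 * e ^ 2 < 2 * e + (κ ^ 2 + κ + 1) * (2 * e - κ * 2) := by
  nlinarith [mul_nonneg (sub_nonneg.2 (Int.add_one_le_iff.2 h1)) (sub_nonneg.2 h2)]

theorem sq_lt_of_sq_add_one_lt {e κ s ρ : ℤ} (hκ : 0 < κ) (h : κ ^ 2 + 1 < e) (hs : 0 < s)
    (hρ : 0 ≤ ρ) (hρ' : ρ < 2 * κ) (he : e = 2 * κ * (s - 1) + ρ) :
    2 * e ^ 2 < 2 * e + (κ ^ 2 + κ + 1) * (2 * s * e - κ * s * (s + 1)) := by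
  have hs2 : 2 ≤ s := by
    by_contra! hlt
    have : s = 1 := by omega
    subst this
    nlinarith [sq_nonneg (κ - 1)]
  have hval : 2 * s * e - κ * s * (s + 1) = κ * s * (3 * s - 5) + 2 * s * ρ := by
    rw [he]; ring
  have hpos : 0 ≤ κ * s * (3 * s - 5) + 2 * s * ρ := by
    have : 0 ≤ κ * s * (3 * s - 5) := by
      apply mul_nonneg (by positivity); omega
    positivity
  rw [hval]
  rcases (show κ = 1 ∨ 2 ≤ κ by omega) with rfl | hκ2
  · rcases (show ρ = 0 ∨ ρ = 1 by omega) with rfl | rfl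
    · have : 3 ≤ s := by omega
      subst he; nlinarith
    · subst he; nlinarith
  · have hq : 7 * κ ≤ 2 * (κ ^ 2 + κ + 1) := by nlinarith
    have h1 := mul_le_mul_of_nonneg_right hq hpos
    have h2 : 0 ≤ ρ * (2 * κ - ρ) := mul_nonneg hρ (by omega)
    have h3 : 0 ≤ (s - 2) * (2 * κ - ρ) * κ :=
      mul_nonneg (mul_nonneg (by omega) (by omega)) (by omega)
    have h4 : 0 ≤ (s - 2) * κ ^ 2 := mul_nonneg (by omega) (by positivity)
    have h5 : 0 ≤ (s - 2) ^ 2 * κ ^ 2 := by positivity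
    have h6 : 0 ≤ (s - 2) * κ * ρ := mul_nonneg (mul_nonneg (by omega) (by omega)) hρ
    have h7 : 0 ≤ κ * ρ := by positivity
    have h8 : e ^ 2 = 4 * κ ^ 2 * (s - 1) ^ 2 + 4 * κ * (s - 1) * ρ + ρ ^ 2 := by rw [he]; ring
    nlinarith

/-- **Theorem 1 (main theorem).** Let `Γ` be a vertex-primitive digraph on `Ω` with
`Γ ≠ ∅` and `Γ ≠ Ω × Ω`, of order `n` and valency `d`.  If `κ` is the smallest positive
`i` such that `Γ_i ≠ ∅`, then either `Γ_0 ∪ Γ_κ = Ω × Ω` and `(n-1)(d-κ) = d(d-1)`, or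
there is `i` with `κ ≤ i ≤ d-1` such that `Γ_i ≠ ∅` and every vertex has valency between
`1` and `κ² + κ` in `Γ_i`. -/
theorem stmt_0 {Ω : Type*} [Fintype Ω] (Γ : Set (Ω × Ω))
    (hprim : VertexPrimitive Γ) (hne : Γ ≠ ∅) (hnu : Γ ≠ Set.univ)
    (n d : ℕ) (hn : n = Fintype.card Ω)
    (hreg : ∀ v : Ω, (nbhd Γ v).ncard = d)
    (κ : ℕ) (hκpos : 0 < κ) (hκne : GammaI Γ d κ ≠ ∅)
    (hκmin : ∀ j : ℕ, 0 < j → j < κ → GammaI Γ d j = ∅) :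
    (GammaI Γ d 0 ∪ GammaI Γ d κ = Set.univ ∧ (n - 1) * (d - κ) = d * (d - 1)) ∨
    (∃ i : ℕ, κ ≤ i ∧ i ≤ d - 1 ∧ GammaI Γ d i ≠ ∅ ∧
      ∀ v : Ω, 1 ≤ (nbhd (GammaI Γ d i) v).ncard ∧
        (nbhd (GammaI Γ d i) v).ncard ≤ κ ^ 2 + κ) := by
  classical
  subst hn
  obtain ⟨⟨a, b⟩, hab⟩ := Set.nonempty_iff_ne_empty.2 hκne
  rw [mem_GammaI_iff hreg] at hab
  have hdpos : 0 < d := by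
    obtain ⟨⟨x, y⟩, hxy⟩ := Set.nonempty_iff_ne_empty.2 hne
    rw [← hreg x, Set.ncard_pos (Set.toFinite _)]
    exact ⟨y, hxy⟩
  have hdn : d < Fintype.card Ω := by
    by_contra! hge
    refine hnu (Set.eq_univ_of_forall fun ⟨x, y⟩ => ?_)
    have : nbhd Γ x = Set.univ := Set.eq_of_subset_of_ncard_le (Set.subset_univ _)
      (by rw [hreg, Set.ncard_univ, Nat.card_eq_fintype_card]; exact hge) (Set.toFinite _)
    rw [← mem_nbhd, this]
    exact Set.mem_univ y
  have hmin : ∀ {v u : Ω}, v ≠ u → κ ≤ nbhdDist Γ v u := by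
    intro v u hvu
    by_contra! hlt
    have hpos := hprim.nbhdDist_pos hne hreg hdn hvu
    exact Set.eq_empty_iff_forall_notMem.1 (hκmin _ hpos hlt) (v, u)
      ((mem_GammaI_iff hreg).2 rfl)
  set e := min d (Fintype.card Ω - d) with he
  have hepos : 0 < e := by omega
  have hle : ∀ v u, nbhdDist Γ v u ≤ e := by
    intro v u
    have h1 := ncard_inter_add_nbhdDist hreg v u
    have h2 := nbhdDist_add_le_card hreg v u
    omega
  have hκe : κ ≤ e := hab ▸ hle a b
  rcases hκe.eq_or_lt with hκe | hκe
  · left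
    have heq : ∀ v u, v ≠ u → nbhdDist Γ v u = κ := fun v u h =>
      le_antisymm (hκe ▸ hle v u) (hmin h)
    constructor
    · refine Set.eq_univ_of_forall fun ⟨v, u⟩ => ?_
      by_cases h : v = u
      · exact Or.inl ((mem_GammaI_iff hreg).2 (h ▸ nbhdDist_self v))
      · exact Or.inr ((mem_GammaI_iff hreg).2 (heq v u h))
    · have hsum := hprim.sum_ncard_inter hreg a
      rw [← Finset.add_sum_erase _ _ (Finset.mem_univ a), Set.inter_self, hreg,
        Finset.sum_congr rfl (g := fun _ => d - κ), Finset.sum_const,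
        Finset.card_erase_of_mem (Finset.mem_univ a), Finset.card_univ, smul_eq_mul] at hsum
      · rw [Nat.mul_sub d, mul_one]
        omega
      · intro u hu
        have h1 := ncard_inter_add_nbhdDist hreg a u
        rw [heq a u (Finset.ne_of_mem_erase hu).symm] at h1
        omega
  right
  by_contra! hcon
  have hncard : ∀ i v, (nbhd (GammaI Γ d i) v).ncard =
      (Finset.univ.filter fun u => nbhdDist Γ v u = i).card := by
    intro i v
    rw [Set.ncard_eq_toFinset_card']
    congr 1
    ext u
    simp [mem_nbhd, mem_GammaI_iff hreg]
  have hmany : ∀ u, 0 < nbhdDist Γ a u → nbhdDist Γ a u < e →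
      κ ^ 2 + κ < (Finset.univ.filter fun w => nbhdDist Γ a w = nbhdDist Γ a u).card := by
    intro u hpos hlt
    have hau : a ≠ u := by
      rintro rfl
      simp [nbhdDist_self] at hpos
    obtain ⟨v, hv⟩ := hcon (nbhdDist Γ a u) (hmin hau) (by omega)
      ⟨(a, u), (mem_GammaI_iff hreg).2 rfl⟩
    have hva : (nbhd (GammaI Γ d (nbhdDist Γ a u)) v).ncard =
        (Finset.univ.filter fun w => nbhdDist Γ a w = nbhdDist Γ a u).card := by
      obtain ⟨g, hg, rfl⟩ := hprim.exists_apply_eq a v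
      rw [hncard]
      symm
      refine Finset.card_bij (fun w _ => g w) ?_ (fun _ _ _ _ h => g.injective h) ?_
      · intro w hw
        simpa [nbhdDist_of_mem_digraphAut hg] using hw
      · intro w hw
        obtain ⟨w, rfl⟩ := g.surjective w
        exact ⟨w, by simpa [nbhdDist_of_mem_digraphAut hg] using hw, rfl⟩
    rw [hva] at hv
    exact hv (Finset.card_pos.2 ⟨u, by simp⟩)
  have hedn : e * e + d * Fintype.card Ω = d * d + e * Fintype.card Ω := by
    rcases min_choice d (Fintype.card Ω - d) with h | h
    · rw [he, h]
    · have : d + e = Fintype.card Ω := by omega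
      rw [← this]; ring
  have hsumdist := hprim.sum_nbhdDist hreg a
  have htotal : ∑ u, ((e : ℤ) - nbhdDist Γ a u) = (e : ℤ) ^ 2 := by
    rw [Finset.sum_sub_distrib, Finset.sum_const, Finset.card_univ, nsmul_eq_mul]
    zify at hsumdist hedn
    linarith
  obtain ⟨w, hw⟩ : ∃ w, e < 2 * nbhdDist Γ a w := by
    by_contra! hall
    have h1 : ∑ u ∈ Finset.univ.erase a, 2 * nbhdDist Γ a u ≤ (Fintype.card Ω - 1) * e := by
      rw [← Finset.card_univ, ← Finset.card_erase_of_mem (Finset.mem_univ a), ← smul_eq_mul,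
        ← Finset.sum_const]
      exact Finset.sum_le_sum fun u _ => hall u
    rw [← Finset.mul_sum] at h1
    rw [← Finset.add_sum_erase _ _ (Finset.mem_univ a), nbhdDist_self, zero_add] at hsumdist
    have h2 : 2 * e ≤ Fintype.card Ω := by omega
    obtain ⟨m, hm⟩ : ∃ m, Fintype.card Ω = m + 1 := ⟨Fintype.card Ω - 1, by omega⟩
    rw [hm] at h1 h2 hsumdist hedn
    simp only [Nat.add_sub_cancel] at h1
    nlinarith
  have hbound : ∀ s : ℕ, (∀ j < s, 2 * (j * κ) ≤ e) →
      2 * (e : ℤ) + (κ ^ 2 + κ + 1) * (2 * s * e - κ * s * (s + 1)) ≤ 2 * (e : ℤ) ^ 2 := by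
    intro s hs
    have h1 := le_sum_sub_of_gaps (nbhdDist Γ a) a (κ := κ) (nbhdDist_self a) (hle a) hmany s
      fun j hj => hprim.exists_nbhdDist_mem_Ioc hreg hκpos hab (w := w)
        (by have := hs j hj; omega)
    have h2 := Finset.sum_le_sum_of_subset_of_nonneg (f := fun u => (e : ℤ) - nbhdDist Γ a u)
      (Finset.filter_subset (fun u => nbhdDist Γ a u ≤ s * κ) Finset.univ)
      (fun u _ _ => by have := hle a u; omega)
    rw [htotal] at h2
    push_cast at h1
    linarith
  rcases le_or_gt e (κ ^ 2 + 1) with hsmall | hlarge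
  · have h1 := hbound 1 (by simp)
    have h2 := sq_lt_of_le_sq_add_one (e := e) (κ := κ) (by omega)
      (by exact_mod_cast hsmall)
    push_cast at h1
    linarith
  · have h1 := hbound (e / (2 * κ) + 1) (fun j hj => by
      have := Nat.mul_le_mul_left (2 * κ) (Nat.lt_succ_iff.1 hj)
      have := Nat.mul_div_le e (2 * κ)
      linarith)
    have h2 := sq_lt_of_sq_add_one_lt (e := e) (κ := κ) (s := (e / (2 * κ) + 1 : ℕ))
      (ρ := (e % (2 * κ) : ℕ)) (by omega) (by exact_mod_cast hlarge) (by positivity)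
      (by positivity)
      (by exact_mod_cast Nat.mod_lt e (by omega : 2 * κ > 0))
      (by
        have := Nat.div_add_mod e (2 * κ)
        zify at this
        push_cast
        linarith)
    push_cast at h1 h2
    linarith
end

section
/- Let Ω be a finite set, let G be a primitive permutation group on Ω, let p ≥ 2, and let f : Ω → Ω be a map whose kernel type is (p, 2, 1, …, 1); that is, the partition of Ω into fibres of f has exactly one part of size p, exactly one part of size 2, and all other parts of size 1. Then G synchronises f: the semigroup of maps Ω → Ω generated under composition by the elements of G together with f contains a constant map. -/
/-- A binary relation on `Ω` preserved by every element of the permutation group `G`. -/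
def InvariantRel {Ω : Type*} (G : Subgroup (Equiv.Perm Ω)) (F : Ω → Ω → Prop) : Prop :=
  ∀ g ∈ G, ∀ u v : Ω, F u v ↔ F (g u) (g v)

theorem IsPrimitiveSubgroup.exists_apply_eq {Ω : Type*} {G : Subgroup (Equiv.Perm Ω)}
    (hG : IsPrimitiveSubgroup G) (u v : Ω) : ∃ g ∈ G, g u = v := by
  obtain ⟨g, hg⟩ := hG.1.exists_smul_eq u v
  exact ⟨g.1, g.2, hg⟩

/-- An invariant equivalence relation of a primitive group that relates two distinct points
is universal. -/
theorem IsPrimitiveSubgroup.rel_of_equivalence {Ω : Type*} {G : Subgroup (Equiv.Perm Ω)}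
    (hG : IsPrimitiveSubgroup G) {r : Ω → Ω → Prop} (hr : Equivalence r)
    (hinv : InvariantRel G r) {u w : Ω} (huw : u ≠ w) (h : r u w) (a b : Ω) : r a b := by
  have hB : MulAction.IsBlock G {v | r u v} := by
    rw [MulAction.isBlock_iff_smul_eq_of_nonempty]
    rintro g ⟨v, ⟨v', hv', rfl⟩, hv⟩
    have h1 : r u (g.1 v') := hv
    have h2 : r (g.1 u) (g.1 v') := (hinv g.1 g.2 _ _).1 hv'
    have h3 : r u (g.1 u) := hr.trans h1 (hr.symm h2)
    ext x
    rw [Set.mem_smul_set_iff_inv_smul_mem]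
    have h4 : r u (g⁻¹ • x) ↔ r (g.1 u) (g.1 (g⁻¹ • x)) := hinv g.1 g.2 _ _
    have h5 : g.1 (g⁻¹ • x) = x := smul_inv_smul g x
    rw [h5] at h4
    exact h4.trans ⟨fun k => hr.trans h3 k, fun k => hr.trans (hr.symm h3) k⟩
  rcases hG.2 _ hB with hs | hu
  · exact absurd (hs (hr.refl u) h) huw
  · have key : ∀ x, r u x := fun x => by
      have : x ∈ {v | r u v} := hu ▸ Set.mem_univ x
      exact this
    exact hr.trans (hr.symm (key a)) (key b)

/-- A doubly infinite walk without backtracking in the graph `R`. -/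
def IsReducedWalk {Ω : Type*} (R : Ω → Ω → Prop) (c : ℤ → Ω) : Prop :=
  ∀ i, R (c i) (c (i + 1)) ∧ c i ≠ c (i + 2)

theorem IsReducedWalk.ext {Ω : Type*} {R : Ω → Ω → Prop} (hsymm : ∀ u v, R u v → R v u)
    (htwo : ∀ u, ∃ v w, v ≠ w ∧ ∀ x, R u x ↔ x = v ∨ x = w) {c c' : ℤ → Ω}
    (hc : IsReducedWalk R c) (hc' : IsReducedWalk R c') (h0 : c 0 = c' 0) (h1 : c 1 = c' 1)
    (i : ℤ) : c i = c' i := by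
  have huniq : ∀ u x y t, R u x → R u y → R u t → t ≠ x → t ≠ y → x = y := by
    intro u x y t hx hy ht htx hty
    obtain ⟨v, w, -, h⟩ := htwo u
    rw [h] at hx hy ht
    grind
  suffices H : c i = c' i ∧ c (i + 1) = c' (i + 1) from H.1
  induction i using Int.induction_on with
  | zero => exact ⟨h0, by simpa using h1⟩
  | succ i ih =>
    refine ⟨ih.2, ?_⟩
    have a1 := hc (i + 1)
    have a2 := hc' (i + 1)
    have b1 := hc i
    have b2 := hc' i
    rw [show (i : ℤ) + 2 = i + 1 + 1 by ring] at b1 b2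
    refine huniq (c (i + 1)) _ _ (c i) a1.1 (ih.2 ▸ a2.1) (hsymm _ _ b1.1) b1.2 ?_
    rw [ih.1]
    exact b2.2
  | pred i ih =>
    have a1 := hc (-i - 1)
    have a2 := hc' (-i - 1)
    have b1 := hc (-i)
    have b2 := hc' (-i)
    rw [show (-i : ℤ) - 1 + 2 = -i + 1 by ring, show (-i : ℤ) - 1 + 1 = -i by ring] at a1 a2
    rw [show (-i : ℤ) - 1 + 1 = -i by ring]
    refine ⟨huniq (c (-i)) _ _ (c (-i + 1)) (hsymm _ _ a1.1) ?_ b1.1 a1.2.symm ?_, ih.1⟩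
    · rw [ih.1]
      exact hsymm _ _ a2.1
    · rw [ih.2]
      exact a2.2.symm

theorem IsReducedWalk.translate {Ω : Type*} {R : Ω → Ω → Prop} {c : ℤ → Ω} (hc : IsReducedWalk R c) (k : ℤ) :
    IsReducedWalk R fun t => c (k + t) := by
  intro i
  simpa only [add_assoc] using hc (k + i)

theorem IsReducedWalk.reflect {Ω : Type*} {R : Ω → Ω → Prop} (hsymm : ∀ u v, R u v → R v u) {c : ℤ → Ω}
    (hc : IsReducedWalk R c) (k : ℤ) : IsReducedWalk R fun t => c (k - t) := by
  intro i
  constructor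
  · have := (hc (k - (i + 1))).1
    rw [show k - (i + 1) + 1 = k - i by ring] at this
    exact hsymm _ _ this
  · have := (hc (k - (i + 2))).2
    rw [show k - (i + 2) + 2 = k - i by ring] at this
    exact this.symm

theorem IsReducedWalk.adj_iff {Ω : Type*} {R : Ω → Ω → Prop} (hsymm : ∀ u v, R u v → R v u)
    (htwo : ∀ u, ∃ v w, v ≠ w ∧ ∀ x, R u x ↔ x = v ∨ x = w) {c : ℤ → Ω}
    (hc : IsReducedWalk R c) (i : ℤ) (x : Ω) : R (c i) x ↔ x = c (i + 1) ∨ x = c (i - 1) := by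
  obtain ⟨v, w, -, h⟩ := htwo (c i)
  have h1 := (hc i).1
  have h2 := hc (i - 1)
  rw [show i - 1 + 1 = i by ring, show i - 1 + 2 = i + 1 by ring] at h2
  have h3 := hsymm _ _ h2.1
  have h4 := h2.2
  rw [h] at h1 h3 ⊢
  grind

theorem exists_isReducedWalk {Ω : Type*} {R : Ω → Ω → Prop} (hsymm : ∀ u v, R u v → R v u)
    (htwo : ∀ u, ∃ v w, v ≠ w ∧ ∀ x, R u x ↔ x = v ∨ x = w) {u v : Ω} (huv : R u v) :
    ∃ c, IsReducedWalk R c := by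
  have hother : ∀ d : {q : Ω × Ω // R q.1 q.2}, ∃ o, R d.1.2 o ∧ o ≠ d.1.1 ∧
      ∀ x, R d.1.2 x → x ≠ d.1.1 → x = o := by
    rintro ⟨⟨a, b⟩, hab⟩
    obtain ⟨v, w, hvw, h⟩ := htwo b
    rcases (h a).1 (hsymm _ _ hab) with rfl | rfl
    · exact ⟨w, (h w).2 (Or.inr rfl), hvw.symm, fun x hx hne => ((h x).1 hx).resolve_left hne⟩
    · exact ⟨v, (h v).2 (Or.inl rfl), hvw, fun x hx hne => ((h x).1 hx).resolve_right hne⟩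
  choose o ho1 ho2 ho3 using hother
  let rev : {q : Ω × Ω // R q.1 q.2} → {q : Ω × Ω // R q.1 q.2} :=
    fun d => ⟨(d.1.2, d.1.1), hsymm _ _ d.2⟩
  let next : {q : Ω × Ω // R q.1 q.2} → {q : Ω × Ω // R q.1 q.2} :=
    fun d => ⟨(d.1.2, o d), ho1 d⟩
  have hinv : ∀ d, rev (next (rev (next d))) = d := by
    intro d
    apply Subtype.ext
    apply Prod.ext
    · exact (ho3 (rev (next d)) d.1.1 (hsymm _ _ d.2) (ho2 d).symm).symm
    · rfl
  let s : Equiv.Perm {q : Ω × Ω // R q.1 q.2} :=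
    { toFun := next
      invFun := fun d => rev (next (rev d))
      left_inv := hinv
      right_inv := fun d => congrArg rev (hinv (rev d)) }
  let d : ℤ → {q : Ω × Ω // R q.1 q.2} := fun i => (s ^ i) ⟨(u, v), huv⟩
  have hd : ∀ i, d (i + 1) = next (d i) := by
    intro i
    change (s ^ (i + 1)) _ = s ((s ^ i) _)
    rw [add_comm, zpow_add, zpow_one, Equiv.Perm.mul_apply]
  refine ⟨fun i => (d i).1.1, fun i => ⟨?_, ?_⟩⟩
  · change R (d i).1.1 (d (i + 1)).1.1
    rw [hd]
    exact (d i).2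
  · change (d i).1.1 ≠ (d (i + 2)).1.1
    rw [show i + 2 = i + 1 + 1 by ring, hd, hd]
    exact (ho2 (d i)).symm

section

open Classical Finset

/-- The number of out-neighbours of `u` in `X` that are not out-neighbours of `v`. -/
noncomputable def nbhdDiff {Ω : Type*} [Fintype Ω] (X : Ω → Ω → Prop) (u v : Ω) : ℕ :=
  #{x | X u x ∧ ¬ X v x}

variable {Ω : Type*} [Fintype Ω] {G : Subgroup (Equiv.Perm Ω)}

theorem InvariantRel.card_eq (hG : IsPrimitiveSubgroup G) {F : Ω → Ω → Prop}
    (hF : InvariantRel G F) (u w : Ω) : #{x | F u x} = #{x | F w x} := by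
  obtain ⟨g, hg, rfl⟩ := hG.exists_apply_eq u w
  refine card_bij (fun x _ => g x) ?_ (fun _ _ _ _ h => g.injective h) ?_
  · intro x hx
    simpa using (hF g hg u x).1 (by simpa using hx)
  · intro y hy
    refine ⟨g.symm y, ?_, by simp⟩
    have := (hF g hg u (g.symm y)).2 (by simpa using hy)
    simpa using this

/-- If one neighbourhood of an invariant relation of a primitive group contains another one, then
all neighbourhoods agree. -/
theorem InvariantRel.iff_of_subset (hG : IsPrimitiveSubgroup G) {F : Ω → Ω → Prop}
    (hF : InvariantRel G F) {u w : Ω} (huw : u ≠ w) (h : ∀ x, F u x → F w x) (a b x : Ω) :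
    F a x ↔ F b x := by
  have heq : ({x | F u x} : Finset Ω) = ({x | F w x} : Finset Ω) := by
    apply eq_of_subset_of_card_le
    · intro x hx
      simpa using h x (by simpa using hx)
    · rw [hF.card_eq hG u w]
  refine hG.rel_of_equivalence (r := fun a b => ∀ x, F a x ↔ F b x)
    ⟨fun _ _ => Iff.rfl, fun h x => (h x).symm, fun h k x => (h x).trans (k x)⟩ ?_ huw ?_ a b x
  · intro g hg u v
    constructor
    · intro h x
      have h1 := hF g hg u (g.symm x)
      have h2 := hF g hg v (g.symm x)
      simp only [Equiv.apply_symm_apply] at h1 h2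
      rw [← h1, ← h2]
      exact h _
    · intro h x
      rw [hF g hg, hF g hg v]
      exact h _
  · intro x
    have := congrArg (x ∈ ·) heq
    simpa using this

theorem InvariantRel.nbhdDiff_apply {X : Ω → Ω → Prop} (hX : InvariantRel G X)
    {g : Equiv.Perm Ω} (hg : g ∈ G) (u v : Ω) :
    nbhdDiff X (g u) (g v) = nbhdDiff X u v := by
  symm
  refine card_bij (fun x _ => g x) ?_ (fun _ _ _ _ h => g.injective h) ?_
  · intro x hx
    simpa [← hX g hg] using hx
  · intro y hy
    refine ⟨g.symm y, ?_, by simp⟩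
    have h1 := hX g hg u (g.symm y)
    have h2 := hX g hg v (g.symm y)
    simp only [Equiv.apply_symm_apply] at h1 h2
    simpa [h1, h2] using hy

theorem nbhdDiff_self (X : Ω → Ω → Prop) (u : Ω) : nbhdDiff X u u = 0 := by
  simp [nbhdDiff]

theorem InvariantRel.nbhdDiff_comm (hG : IsPrimitiveSubgroup G) {X : Ω → Ω → Prop}
    (hX : InvariantRel G X) (u v : Ω) : nbhdDiff X u v = nbhdDiff X v u := by
  have h := card_sdiff_add_card_inter ({x | X u x} : Finset Ω) ({x | X v x} : Finset Ω)
  have h' := card_sdiff_add_card_inter ({x | X v x} : Finset Ω) ({x | X u x} : Finset Ω)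
  rw [inter_comm] at h'
  have e : ∀ a b, nbhdDiff X a b =
      #(({x | X a x} : Finset Ω) \ ({x | X b x} : Finset Ω)) := by
    intro a b
    unfold nbhdDiff
    congr 1
    ext x
    simp
  have := hX.card_eq hG u v
  rw [e, e]
  omega

theorem nbhdDiff_eq_zero_iff (X : Ω → Ω → Prop) (u v : Ω) :
    nbhdDiff X u v = 0 ↔ ∀ x, X u x → X v x := by
  simp [nbhdDiff, filter_eq_empty_iff]

theorem InvariantRel.eq_of_nbhdDiff_eq_zero (hG : IsPrimitiveSubgroup G) {X : Ω → Ω → Prop}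
    (hX : InvariantRel G X) (hirr : ∀ u, ¬ X u u) (hedge : ∃ u v, X u v) {u v : Ω}
    (h : nbhdDiff X u v = 0) : u = v := by
  by_contra huv
  rw [nbhdDiff_eq_zero_iff] at h
  obtain ⟨a, b, hab⟩ := hedge
  exact hirr b ((hX.iff_of_subset hG huv h a b b).1 hab)

/-- If the neighbourhoods of `u` and `w` differ by exchanging `x` for `y`, then the points `v` with
`nbhdDiff X u v < nbhdDiff X w v` are adjacent to `x` but not to `y`. -/
theorem adj_of_nbhdDiff_lt {X : Ω → Ω → Prop} {u w x y : Ω}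
    (hx : ∀ t, X u t ∧ ¬ X w t ↔ t = x) (hy : ∀ t, X w t ∧ ¬ X u t ↔ t = y) (v : Ω)
    (h : nbhdDiff X u v < nbhdDiff X w v) :
    X v x ∧ ¬ X v y ∧ nbhdDiff X w v = nbhdDiff X u v + 1 := by
  have hle : nbhdDiff X w v ≤ nbhdDiff X u v + 1 := by
    refine (card_le_card (t := insert y ({t | X u t ∧ ¬ X v t} : Finset Ω)) ?_).trans
      (card_insert_le _ _)
    intro t ht
    have := hy t
    simp only [mem_filter, mem_univ, true_and, mem_insert] at ht ⊢
    tauto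
  have hvy : ¬ X v y := by
    intro hvy
    refine absurd h (not_lt.2 (card_le_card ?_))
    intro t ht
    have h1 := hy t
    simp only [mem_filter, mem_univ, true_and] at ht ⊢
    by_cases hty : t = y
    · exact absurd (hty ▸ hvy) ht.2
    · tauto
  refine ⟨?_, hvy, by omega⟩
  by_contra hvx
  refine absurd h (not_lt.2 ?_)
  have hxm : x ∈ ({t | X u t ∧ ¬ X v t} : Finset Ω) := by
    simpa using ⟨((hx x).2 rfl).1, hvx⟩
  have h2 : nbhdDiff X w v ≤ #(insert y (({t | X u t ∧ ¬ X v t} : Finset Ω).erase x)) := by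
    refine card_le_card ?_
    intro t ht
    have h1 := hy t
    have h3 := hx t
    simp only [mem_filter, mem_univ, true_and, mem_insert, mem_erase] at ht ⊢
    tauto
  have h3 := card_insert_le y (({t | X u t ∧ ¬ X v t} : Finset Ω).erase x)
  have h4 := card_erase_add_one hxm
  unfold nbhdDiff at *
  omega

/-- For `i` below the maximal neighbourhood difference, the balls of radius `i` around two points
are distinct. -/
theorem InvariantRel.exists_nbhdDiff_le_lt (hG : IsPrimitiveSubgroup G) {X : Ω → Ω → Prop}
    (hX : InvariantRel G X) {u w : Ω} (huw : u ≠ w) {i : ℕ}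
    (hi : ∃ a b, i < nbhdDiff X a b) : ∃ v, nbhdDiff X u v ≤ i ∧ i < nbhdDiff X w v := by
  by_contra! hcon
  obtain ⟨a, b, hab⟩ := hi
  have hF : InvariantRel G (fun a b => nbhdDiff X a b ≤ i) := by
    intro g hg u v
    simp only [hX.nbhdDiff_apply hg]
  have := (hF.iff_of_subset hG huw hcon b a b).1 (by simp [nbhdDiff_self])
  omega

theorem InvariantRel.exists_swap (hG : IsPrimitiveSubgroup G) {X : Ω → Ω → Prop}
    (hX : InvariantRel G X) {u w : Ω} (h : nbhdDiff X u w = 1) :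
    ∃ x y, (∀ t, X u t ∧ ¬ X w t ↔ t = x) ∧ (∀ t, X w t ∧ ¬ X u t ↔ t = y) := by
  obtain ⟨x, hx⟩ := card_eq_one.1 h
  obtain ⟨y, hy⟩ := card_eq_one.1 ((hX.nbhdDiff_comm hG w u).trans h)
  refine ⟨x, y, fun t => ?_, fun t => ?_⟩
  · simpa using congrArg (t ∈ ·) hx
  · simpa using congrArg (t ∈ ·) hy

/-- Neighbouring balls of radius `1` differ in a single point. -/
theorem InvariantRel.eq_of_nbhdDiff_le_one_lt (hG : IsPrimitiveSubgroup G) {X : Ω → Ω → Prop}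
    (hX : InvariantRel G X) (hsymm : ∀ u v, X u v → X v u) {u w : Ω}
    (h : nbhdDiff X u w = 1) {v v' : Ω}
    (hv : nbhdDiff X u v ≤ 1 ∧ 1 < nbhdDiff X w v)
    (hv' : nbhdDiff X u v' ≤ 1 ∧ 1 < nbhdDiff X w v') : v = v' := by
  have huw : u ≠ w := by
    rintro rfl
    simp [nbhdDiff_self] at h
  obtain ⟨x, y, hx, hy⟩ := hX.exists_swap hG h
  obtain ⟨⟨a, b⟩, -, hmax⟩ := exists_max_image (univ : Finset (Ω × Ω))
    (fun q => nbhdDiff X q.1 q.2) ⟨(u, u), mem_univ _⟩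
  set U : Finset Ω := {v | nbhdDiff X u v < nbhdDiff X w v} with hU
  have hUcard : #U ≤ nbhdDiff X a b := by
    refine le_trans (card_le_card ?_) (hmax (x, y) (mem_univ _))
    intro t ht
    have := adj_of_nbhdDiff_lt hx hy t (by simpa [hU] using ht)
    simpa using ⟨hsymm _ _ this.1, fun h => this.2.1 (hsymm _ _ h)⟩
  have himg : range (nbhdDiff X a b) ⊆ U.image (nbhdDiff X u) := by
    intro i hi
    obtain ⟨t, ht1, ht2⟩ := hX.exists_nbhdDiff_le_lt hG huw ⟨a, b, mem_range.1 hi⟩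
    have := adj_of_nbhdDiff_lt hx hy t (by omega)
    exact mem_image.2 ⟨t, by simp [hU]; omega, by omega⟩
  have hinj : Set.InjOn (nbhdDiff X u) U := by
    apply injOn_of_card_image_eq
    refine le_antisymm card_image_le ?_
    have := card_le_card himg
    rw [card_range] at this
    omega
  have e1 := adj_of_nbhdDiff_lt hx hy v (by omega)
  have e2 := adj_of_nbhdDiff_lt hx hy v' (by omega)
  refine hinj ?_ ?_ (by omega)
  · simp [hU]; omega
  · simp [hU]; omega

/-- If all neighbourhoods of a non-complete graph differ in at most one point, then the graph
is empty. -/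
theorem InvariantRel.exists_one_lt_nbhdDiff (hG : IsPrimitiveSubgroup G) {X : Ω → Ω → Prop}
    (hX : InvariantRel G X) (hsymm : ∀ u v, X u v → X v u) (hirr : ∀ u, ¬ X u u)
    (hedge : ∃ u v, X u v) (hne : ∃ u v, u ≠ v ∧ ¬ X u v) : ∃ a b, 1 < nbhdDiff X a b := by
  by_contra! hcon
  obtain ⟨u, w, huw⟩ := hedge
  obtain ⟨a, b, hab, hnab⟩ := hne
  have hF : InvariantRel G (fun a b => a = b ∨ X a b) := by
    intro g hg a b
    simp [hX g hg a b]
  have hsub : ∀ x, (u = x ∨ X u x) → (w = x ∨ X w x) := by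
    intro x hx
    rcases hx with rfl | hx
    · exact Or.inr (hsymm _ _ huw)
    · by_contra! hcx
      exact hcx.1 (card_le_one.1 (hcon u w) w (by simp [huw, hirr]) x (by simp [hx, hcx.2]))
  have huw' : u ≠ w := by
    rintro rfl
    exact hirr _ huw
  have := (hF.iff_of_subset hG huw' hsub b a b).1 (Or.inl rfl)
  tauto

/-- If neighbouring closed neighbourhoods of a graph with a primitive automorphism group differ in
a single point, then the graph is `2`-regular. -/
theorem InvariantRel.exists_two_nbrs (hG : IsPrimitiveSubgroup G) {R : Ω → Ω → Prop}
    (hR : InvariantRel G R) (hsymm : ∀ u v, R u v → R v u) (hirr : ∀ u, ¬ R u u)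
    (hedge : ∃ u v, R u v)
    (hball : ∀ u w, R u w → ∃ v, (R u v ∧ v ≠ w ∧ ¬ R w v) ∧
      ∀ x, R u x → x ≠ w → ¬ R w x → x = v) (u : Ω) :
    ∃ v w, v ≠ w ∧ ∀ x, R u x ↔ x = v ∨ x = w := by
  obtain ⟨w, huw⟩ : ∃ w, R u w := by
    obtain ⟨a, b, hab⟩ := hedge
    obtain ⟨g, hg, rfl⟩ := hG.exists_apply_eq a u
    exact ⟨g b, (hR g hg a b).1 hab⟩
  obtain ⟨w', ⟨huw', hw'w, hww'⟩, hw'⟩ := hball u w huw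
  refine ⟨w, w', hw'w.symm, fun x => ⟨fun hx => ?_, ?_⟩⟩
  swap
  · rintro (rfl | rfl) <;> assumption
  by_contra! hcon
  obtain ⟨hxw, hxw'⟩ := hcon
  have hwx : R w x := by
    by_contra h
    exact hxw' (hw' x hx hxw h)
  have hxw'adj : R x w' := by
    by_contra h
    obtain ⟨n, -, hn⟩ := hball u w' huw'
    exact hxw ((hn x hx hxw' fun k => h (hsymm _ _ k)).trans
      (hn w huw hw'w.symm fun k => hww' (hsymm _ _ k)).symm)
  obtain ⟨v, ⟨hwv, hvu, huv⟩, -⟩ := hball w u (hsymm _ _ huw)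
  have step : ∀ s, R u s → R s v → ∀ t, R s t → t ≠ v → t ≠ u → R v t := by
    intro s hus hsv t hst htv htu
    by_contra h
    obtain ⟨n, -, hn⟩ := hball s v hsv
    exact htu ((hn t hst htv h).trans
      (hn u (hsymm _ _ hus) hvu.symm fun k => huv (hsymm _ _ k)).symm)
  have hne : ∀ t, R u t → t ≠ v ∧ t ≠ u := by
    refine fun t ht => ⟨?_, ?_⟩
    · rintro rfl
      exact huv ht
    · rintro rfl
      exact hirr _ ht
  have hvx : R v x := step w huw hwv x hwx (hne x hx).1 (hne x hx).2
  have hsub : ∀ t, R u t → R v t := by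
    intro t ht
    by_cases htw : t = w
    · exact htw ▸ hsymm _ _ hwv
    by_cases hwt : R w t
    · exact step w huw hwv t hwt (hne t ht).1 (hne t ht).2
    · obtain rfl := hw' t ht htw hwt
      exact step x hx (hsymm _ _ hvx) t hxw'adj (hne t ht).1 (hne t ht).2
  obtain ⟨a, b, hab⟩ := hedge
  exact hirr b ((hR.iff_of_subset hG hvu.symm hsub a b b).1 hab)

/-- If two neighbourhoods of a nontrivial graph with a primitive automorphism group `G` differ by
exchanging one point, then `G` preserves a `2`-regular graph. -/
theorem InvariantRel.exists_two_regular (hG : IsPrimitiveSubgroup G) {X : Ω → Ω → Prop}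
    (hX : InvariantRel G X) (hsymm : ∀ u v, X u v → X v u) (hirr : ∀ u, ¬ X u u)
    (hedge : ∃ u v, X u v) (hne : ∃ u v, u ≠ v ∧ ¬ X u v) (h1 : ∃ u v, nbhdDiff X u v = 1) :
    ∃ R : Ω → Ω → Prop, InvariantRel G R ∧ (∀ u v, R u v → R v u) ∧ (∀ u, ¬ R u u) ∧
      ∀ u, ∃ v w, v ≠ w ∧ ∀ x, R u x ↔ x = v ∨ x = w := by
  have hR : InvariantRel G (fun u v => nbhdDiff X u v = 1) := by
    intro g hg u v
    simp only [hX.nbhdDiff_apply hg]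
  have hRsymm : ∀ u v, nbhdDiff X u v = 1 → nbhdDiff X v u = 1 :=
    fun u v h => (hX.nbhdDiff_comm hG v u).trans h
  have hRirr : ∀ u, ¬ nbhdDiff X u u = 1 := by simp [nbhdDiff_self]
  refine ⟨_, hR, hRsymm, hRirr, hR.exists_two_nbrs hG hRsymm hRirr h1 ?_⟩
  intro u w huw
  have huw' : u ≠ w := by
    rintro rfl
    exact hRirr _ huw
  have hlt : ∀ a x, 1 < nbhdDiff X a x ↔ a ≠ x ∧ nbhdDiff X a x ≠ 1 := by
    intro a x
    constructor
    · intro h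
      refine ⟨?_, by omega⟩
      rintro rfl
      simp [nbhdDiff_self] at h
    · rintro ⟨h, h'⟩
      have : nbhdDiff X a x ≠ 0 := fun k => h (hX.eq_of_nbhdDiff_eq_zero hG hirr hedge k)
      omega
  obtain ⟨v, hv1, hv2⟩ := hX.exists_nbhdDiff_le_lt hG huw'
    (hX.exists_one_lt_nbhdDiff hG hsymm hirr hedge hne)
  have hv := (hlt w v).1 hv2
  refine ⟨v, ⟨?_, hv.1.symm, hv.2⟩, ?_⟩
  · by_contra h
    by_cases huv : u = v
    · subst huv
      exact hv.2 (hRsymm _ _ huw)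
    · have := (hlt u v).2 ⟨huv, h⟩
      omega
  · intro x hux hxw hwx
    exact hX.eq_of_nbhdDiff_le_one_lt hG hsymm huw ⟨hux.le, (hlt w x).2 ⟨hxw.symm, hwx⟩⟩ ⟨hv1, hv2⟩

/-- A graph endomorphism with kernel type `(p, 2, 1, …, 1)` forces two neighbourhoods to
differ in at most one point. -/
theorem InvariantRel.nbhdDiff_le_one_of_hom (hG : IsPrimitiveSubgroup G) {X : Ω → Ω → Prop}
    (hX : InvariantRel G X) (hirr : ∀ u, ¬ X u u) {f : Ω → Ω}
    (hf : ∀ u v, X u v → X (f u) (f v)) {y z : Ω} (hz : (f ⁻¹' {z}).ncard = 2)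
    (hw : ∀ w : Ω, w ≠ y → w ≠ z → (f ⁻¹' {w}).ncard ≤ 1) {a a' : Ω} (ha : f a = y)
    (ha' : f a' = y) : nbhdDiff X a a' ≤ 1 := by
  obtain ⟨b, b', -, hb⟩ := Set.ncard_eq_two.1 hz
  set T : Finset Ω := {t | X y (f t)} with hT
  have hTcard : #(T.erase b) ≤ #({x | X y x} : Finset Ω) := by
    refine card_le_card_of_injOn f ?_ ?_
    · intro t ht
      simpa using (by simpa [hT] using ht : X y (f t) ∧ t ≠ b).1
    · intro s hs t ht hst
      obtain ⟨hys, hsb⟩ : X y (f s) ∧ s ≠ b := by simpa [hT] using hs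
      obtain ⟨hyt, htb⟩ : X y (f t) ∧ t ≠ b := by simpa [hT] using ht
      by_cases hsz : f s = z
      · have h1 : s ∈ f ⁻¹' {z} := hsz
        have h2 : t ∈ f ⁻¹' {z} := hst.symm.trans hsz
        rw [hb] at h1 h2
        simp only [Set.mem_insert_iff, Set.mem_singleton_iff, hsb, htb, false_or] at h1 h2
        rw [h1, h2]
      · have hsy : f s ≠ y := fun h => hirr y (h ▸ hys)
        exact (Set.ncard_le_one (Set.toFinite _)).1 (hw _ hsy hsz) s rfl t hst.symm
  have hTle : #T ≤ #({x | X y x} : Finset Ω) + 1 := by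
    have := pred_card_le_card_erase (s := T) (a := b)
    omega
  have hsub : ∀ c, f c = y → ({x | X c x} : Finset Ω) ⊆ T := by
    intro c hc x hx
    simpa [hT, ← hc] using hf c x (by simpa using hx)
  have h1 : nbhdDiff X a a' ≤ #(T \ ({x | X a' x} : Finset Ω)) := by
    refine card_le_card ?_
    intro x hx
    have hx' : X a x ∧ ¬ X a' x := by simpa using hx
    simpa [hx'.2] using hsub a ha (by simpa using hx'.1)
  have h2 := card_sdiff_add_card_eq_card (hsub a' ha')
  have h3 := hX.card_eq hG a' y
  omega

/-- A primitive group preserving a `2`-regular graph has prime degree (or degree `1`). -/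
theorem InvariantRel.eq_one_or_eq_card_of_dvd (hG : IsPrimitiveSubgroup G) {R : Ω → Ω → Prop}
    (hR : InvariantRel G R) (hsymm : ∀ u v, R u v → R v u) (hirr : ∀ u, ¬ R u u)
    (htwo : ∀ u, ∃ v w, v ≠ w ∧ ∀ x, R u x ↔ x = v ∨ x = w) {u v : Ω} (huv : R u v)
    {q : ℕ} (hq : q ∣ Fintype.card Ω) : q = 1 ∨ q = Fintype.card Ω := by
  obtain ⟨c, hc⟩ := exists_isReducedWalk hsymm htwo huv
  have hnoreflect : ∀ k, ¬ ∀ t, c t = c (k - t) := by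
    intro k hk
    rcases Int.even_or_odd' k with ⟨e, rfl | rfl⟩
    · have h1 := hk (e - 1)
      have h2 := (hc (e - 1)).2
      rw [show e - 1 + 2 = e + 1 by ring] at h2
      rw [show 2 * e - (e - 1) = e + 1 by ring] at h1
      exact h2 h1
    · have h1 := hk e
      have h2 := (hc e).1
      rw [show 2 * e + 1 - e = e + 1 by ring] at h1
      rw [← h1] at h2
      exact hirr _ h2
  have htrans : ∀ i j, c i = c j → ∀ t, c (i + t) = c (j + t) := by
    intro i j hij
    have h1 := (hc i).1
    rw [hij, hc.adj_iff hsymm htwo] at h1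
    rcases h1 with h1 | h1
    · exact (hc.translate i).ext hsymm htwo (hc.translate j) (by simpa using hij) h1
    · exfalso
      have := (hc.translate i).ext hsymm htwo (hc.reflect hsymm j) (by simpa using hij) h1
      refine hnoreflect (i + j) fun t => ?_
      have h := this (t - i)
      simp only [show i + (t - i) = t by ring, show j - (t - i) = i + j - t by ring] at h
      exact h
  have hsurj : Function.Surjective c := by
    have hreach : ∀ a b, Relation.ReflTransGen R a b := by
      have hmono : ∀ g ∈ G, ∀ a b, Relation.ReflTransGen R a b →
          Relation.ReflTransGen R (g a) (g b) :=
        fun g hg a b h => Relation.ReflTransGen.lift g (fun a b => (hR g hg a b).1) _ _ h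
      refine hG.rel_of_equivalence ⟨fun _ => .refl, fun h => ?_, fun h k => h.trans k⟩ ?_
        (u := u) (w := v) ?_ (.single huv)
      · have : Std.Symm R := ⟨hsymm⟩
        exact Relation.ReflTransGen.stdSymm.symm _ _ h
      · refine fun g hg a b => ⟨hmono g hg a b, fun h => ?_⟩
        simpa using hmono g⁻¹ (G.inv_mem hg) _ _ h
      · rintro rfl
        exact hirr _ huv
    intro b
    induction hreach (c 0) b with
    | refl => exact ⟨0, rfl⟩
    | tail _ hab ih =>
      obtain ⟨i, rfl⟩ := ih
      rcases (hc.adj_iff hsymm htwo i _).1 hab with h | h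
      exacts [⟨_, h.symm⟩, ⟨_, h.symm⟩]
  let P : AddSubgroup ℤ :=
    { carrier := {t | c t = c 0}
      zero_mem' := rfl
      add_mem' := by
        intro a b ha hb
        have := htrans a 0 ha b
        rw [zero_add] at this
        exact this.trans hb
      neg_mem' := by
        intro a ha
        have := htrans a 0 ha (-a)
        rw [zero_add, add_neg_cancel] at this
        exact this.symm }
  have hP : ∀ i j, c i = c j ↔ i - j ∈ P := by
    intro i j
    constructor
    · intro h
      have := htrans i j h (-j)
      rwa [add_neg_cancel, ← sub_eq_add_neg] at this
    · intro h
      have := htrans (i - j) 0 h j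
      simpa using this
  have hindex : P.index = Fintype.card Ω := by
    rw [← Nat.card_eq_fintype_card]
    refine Nat.card_congr (Equiv.ofBijective (Quotient.lift c ?_) ⟨?_, ?_⟩)
    · intro a b hab
      rw [eq_comm, hP, ← neg_add_eq_sub]
      exact QuotientAddGroup.leftRel_apply.1 hab
    · rintro ⟨a⟩ ⟨b⟩ hab
      refine Quotient.sound (QuotientAddGroup.leftRel_apply.2 ?_)
      rw [neg_add_eq_sub, ← hP]
      exact Eq.symm hab
    · intro b
      obtain ⟨i, rfl⟩ := hsurj b
      exact ⟨Quotient.mk _ i, rfl⟩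
  have hPdvd : ∀ t, t ∈ P ↔ (Fintype.card Ω : ℤ) ∣ t := by
    intro t
    obtain ⟨N, hN⟩ := Int.subgroup_cyclic P
    rw [← AddSubgroup.zmultiples_eq_closure] at hN
    rw [← hindex, hN, Int.index_zmultiples, Int.mem_zmultiples_iff, Int.natAbs_dvd]
  have hqdvd : ∀ t, t ∈ P → (q : ℤ) ∣ t := fun t ht =>
    (Int.natCast_dvd_natCast.2 hq).trans ((hPdvd t).1 ht)
  have hwalk : ∀ g ∈ G, (∃ k, ∀ t, g (c t) = c (k + t)) ∨ (∃ k, ∀ t, g (c t) = c (k - t)) := by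
    intro g hg
    have hgc : IsReducedWalk R fun t => g (c t) :=
      fun i => ⟨(hR g hg _ _).1 (hc i).1, fun h => (hc i).2 (g.injective h)⟩
    obtain ⟨k, hk⟩ := hsurj (g (c 0))
    have h1 := (hgc 0).1
    simp only [zero_add, ← hk] at h1
    rw [hc.adj_iff hsymm htwo] at h1
    rcases h1 with h1 | h1
    · exact Or.inl ⟨k, hgc.ext hsymm htwo (hc.translate k) (by simp [hk]) h1⟩
    · exact Or.inr ⟨k, hgc.ext hsymm htwo (hc.reflect hsymm k) (by simp [hk]) h1⟩
  let r : Ω → Ω → Prop := fun a b => ∃ i j, c i = a ∧ c j = b ∧ (q : ℤ) ∣ i - j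
  have hr : Equivalence r := by
    refine ⟨?_, ?_, ?_⟩
    · intro a
      obtain ⟨i, rfl⟩ := hsurj a
      exact ⟨i, i, rfl, rfl, by simp⟩
    · rintro _ _ ⟨i, j, rfl, rfl, h⟩
      exact ⟨j, i, rfl, rfl, (dvd_sub_comm).1 h⟩
    · rintro _ _ _ ⟨i, j, rfl, rfl, h⟩ ⟨j', k, hj, rfl, h'⟩
      have := hqdvd _ ((hP _ _).1 hj)
      refine ⟨i, k, rfl, rfl, ?_⟩
      have e : i - k = (i - j) - (j' - j) + (j' - k) := by ring
      rw [e]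
      exact (h.sub this).add h'
  have hrmono : ∀ g ∈ G, ∀ a b, r a b → r (g a) (g b) := by
    rintro g hg _ _ ⟨i, j, rfl, rfl, h⟩
    rcases hwalk g hg with ⟨k, hk⟩ | ⟨k, hk⟩
    · exact ⟨k + i, k + j, (hk i).symm, (hk j).symm, by simpa using h⟩
    · exact ⟨k - i, k - j, (hk i).symm, (hk j).symm, by
        rw [sub_sub_sub_cancel_left]
        exact (dvd_sub_comm).1 h⟩
  by_contra! hcon
  have hpos : 0 < Fintype.card Ω := Fintype.card_pos_iff.2 ⟨u⟩
  have hqpos : 0 < q := Nat.pos_of_dvd_of_pos hq hpos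
  have hqlt : q < Fintype.card Ω := lt_of_le_of_ne (Nat.le_of_dvd hpos hq) hcon.2
  have hne : c 0 ≠ c q := by
    intro h
    have := (hPdvd _).1 ((hP _ _).1 h.symm)
    rw [sub_zero, Int.natCast_dvd_natCast] at this
    exact absurd (Nat.le_of_dvd hqpos this) (by omega)
  obtain ⟨i, j, hi, hj, hij⟩ := hG.rel_of_equivalence hr
    (fun g hg a b => ⟨hrmono g hg a b, fun h => by
      simpa using hrmono g⁻¹ (G.inv_mem hg) _ _ h⟩) hne ⟨0, q, rfl, rfl, by simp⟩ (c 0) (c 1)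
  have h1 := hqdvd _ ((hP _ _).1 hi)
  have h2 := hqdvd _ ((hP _ _).1 hj)
  have h3 : (q : ℤ) ∣ 1 := by
    have e : (1 : ℤ) = (i - 0) - (i - j) - (j - 1) := by ring
    rw [e]
    exact (h1.sub hij).sub h2
  exact hcon.1 (Nat.dvd_one.1 (by exact_mod_cast h3))

/-- If `h` has an image that `h ∘ g` permutes for every `g` in the transitive group `G`, then the
rank of `h` divides the degree. -/
theorem card_image_dvd_card (hG : IsPrimitiveSubgroup G) [Nonempty Ω] (h : Ω → Ω)
    (hinj : ∀ g ∈ G, Set.InjOn (fun x => h (g x)) (univ.image h : Finset Ω)) :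
    #(univ.image h) ∣ Fintype.card Ω := by
  set K : Finset Ω := univ.image h with hK
  obtain ⟨c, hcK⟩ : ∃ c, c ∈ K := ⟨h (Classical.arbitrary Ω), mem_image_of_mem _ (mem_univ _)⟩
  set P : Finset Ω := {x | h x = c} with hP
  let M : Ω → ℕ := fun x => #{g : G | g.1 x ∈ P}
  have hM : ∀ a b, M a = M b := by
    intro a b
    obtain ⟨k, hk, rfl⟩ := hG.exists_apply_eq a b
    refine card_bij (fun g _ => g * ⟨k, hk⟩⁻¹) ?_ (fun _ _ _ _ h => by simpa using h) ?_
    · intro g hg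
      simpa using hg
    · intro g hg
      exact ⟨g * ⟨k, hk⟩, by simpa using hg, by simp⟩
  have h1 : ∑ x ∈ K, M x = Fintype.card G := by
    have : ∀ g : G, #{x ∈ K | g.1 x ∈ P} = 1 := by
      intro g
      have himg : K.image (fun x => h (g.1 x)) = K := by
        apply eq_of_subset_of_card_le
        · intro t ht
          obtain ⟨x, -, rfl⟩ := mem_image.1 ht
          exact mem_image_of_mem _ (mem_univ _)
        · rw [card_image_of_injOn (hinj g.1 g.2)]
      rw [← himg] at hcK
      obtain ⟨x, hx, hxc⟩ := mem_image.1 hcK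
      refine card_eq_one.2 ⟨x, ?_⟩
      ext t
      simp only [mem_filter, hP, mem_univ, true_and, mem_singleton]
      refine ⟨fun ht => hinj g.1 g.2 ht.1 hx (ht.2.trans hxc.symm), ?_⟩
      rintro rfl
      exact ⟨hx, hxc⟩
    calc ∑ x ∈ K, M x = ∑ g : G, #{x ∈ K | g.1 x ∈ P} := by
          simp only [M, card_filter]
          exact sum_comm
      _ = Fintype.card G := by simp [this]
  have h2 : ∑ x, M x = Fintype.card G * #P := by
    have : ∀ g : G, #{x | g.1 x ∈ P} = #P := by
      intro g
      refine card_bij (fun x _ => g.1 x) (fun x hx => by simpa using hx)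
        (fun _ _ _ _ h => g.1.injective h) fun x hx => ⟨g.1.symm x, by simpa using hx, by simp⟩
    calc ∑ x, M x = ∑ g : G, #{x | g.1 x ∈ P} := by
          simp only [M, card_filter]
          exact sum_comm
      _ = Fintype.card G * #P := by simp [this]
  have h3 : ∀ s : Finset Ω, ∑ x ∈ s, M x = #s * M c := fun s => by
    rw [sum_congr rfl fun x _ => hM x c, sum_const, smul_eq_mul]
  rw [h3] at h1 h2
  have hpos : 0 < Fintype.card G := Fintype.card_pos
  have hMpos : 0 < M c := by
    rw [← h1] at hpos
    exact Nat.pos_of_mul_pos_left hpos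
  refine ⟨#P, ?_⟩
  rw [← h1, card_univ] at h2
  refine Nat.eq_of_mul_eq_mul_right hMpos ?_
  rw [h2]
  ring

/-- A primitive group synchronises the maps of kernel type `(p, 2, 1, …, 1)`, stated for an
arbitrary composition-closed set of maps. -/
theorem IsPrimitiveSubgroup.exists_const (hG : IsPrimitiveSubgroup G) {f : Ω → Ω}
    {S : Set (Ω → Ω)} (hcomp : ∀ k ∈ S, ∀ l ∈ S, k ∘ l ∈ S) (hGS : ∀ g ∈ G, ⇑g ∈ S) (hfS : f ∈ S)
    {y z : Ω} (hy : 2 ≤ (f ⁻¹' {y}).ncard) (hz : (f ⁻¹' {z}).ncard = 2)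
    (hw : ∀ w : Ω, w ≠ y → w ≠ z → (f ⁻¹' {w}).ncard ≤ 1) : ∃ k ∈ S, ∃ c : Ω, ∀ x, k x = c := by
  obtain ⟨a, a', haa', ha, ha'⟩ : ∃ a a', a ≠ a' ∧ f a = y ∧ f a' = y := by
    obtain ⟨a, ha, a', ha', h⟩ :=
      (Set.one_lt_ncard_iff_nontrivial_and_finite.1 (by omega : 1 < (f ⁻¹' {y}).ncard)).1
    exact ⟨a, a', h, ha, ha'⟩
  have : Nonempty Ω := ⟨a⟩
  by_contra! hconst
  obtain ⟨h, hhS, hmin⟩ := Set.exists_min_image S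
    (fun k => (univ.image k).card) (Set.toFinite _) ⟨f, hfS⟩
  have hinj : ∀ k ∈ S, Set.InjOn k (univ.image h : Finset Ω) := by
    intro k hk
    apply injOn_of_card_image_eq
    refine le_antisymm card_image_le ?_
    rw [image_image]
    exact hmin (k ∘ h) (hcomp k hk h hhS)
  have hrank : 1 < (univ.image h).card := by
    by_contra! hle
    obtain ⟨x, hx⟩ := hconst h hhS (h a)
    exact hx (card_le_one.1 hle _ (mem_image_of_mem _ (mem_univ _)) _
      (mem_image_of_mem _ (mem_univ _)))
  have hlt : (univ.image h).card < Fintype.card Ω := by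
    refine (hmin f hfS).trans_lt (lt_of_le_of_ne card_image_le fun heq => haa' ?_)
    exact injOn_of_card_image_eq heq (by simp) (by simp) (ha.trans ha'.symm)
  let X : Ω → Ω → Prop := fun u v => ∀ s ∈ S, s u ≠ s v
  have hmono : ∀ k ∈ S, ∀ u v, X u v → X (k u) (k v) := fun k hk u v huv s hs =>
    huv (s ∘ k) (hcomp s hs k hk)
  have hX : InvariantRel G X := fun g hg u v =>
    ⟨hmono g (hGS g hg) u v, fun huv => by
      simpa using hmono (g⁻¹ : Equiv.Perm Ω) (hGS _ (G.inv_mem hg)) _ _ huv⟩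
  have hirr : ∀ u, ¬ X u u := fun u hu => hu f hfS rfl
  have hsymm : ∀ u v, X u v → X v u := fun u v huv s hs => (huv s hs).symm
  have hedge : ∃ u v, X u v := by
    obtain ⟨u, hu, v, hv, huv⟩ := one_lt_card.1 hrank
    exact ⟨u, v, fun s hs heq => huv (hinj s hs hu hv heq)⟩
  have hne : ¬ X a a' := fun hX => hX f hfS (ha.trans ha'.symm)
  have hle := hX.nbhdDiff_le_one_of_hom hG hirr (hmono f hfS) hz hw ha ha'
  have hpos : nbhdDiff X a a' ≠ 0 := fun h0 =>
    haa' (hX.eq_of_nbhdDiff_eq_zero hG hirr hedge h0)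
  obtain ⟨R, hR, hRsymm, hRirr, htwo⟩ := hX.exists_two_regular hG hsymm hirr hedge
    ⟨a, a', haa', hne⟩ ⟨a, a', by omega⟩
  obtain ⟨v, w, -, hv⟩ := htwo a
  have hdvd : #(univ.image h) ∣ Fintype.card Ω :=
    card_image_dvd_card hG h fun g hg => hinj (h ∘ g) (hcomp h hhS g (hGS g hg))
  rcases hR.eq_one_or_eq_card_of_dvd hG hRsymm hRirr htwo ((hv v).2 (Or.inl rfl)) hdvd with
    h1 | h1 <;> omega

end

/-- **Theorem (synchronisation).** Let `G` be a primitive permutation group on a finite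
set `Ω` and let `f : Ω → Ω` be a map of kernel type `(p, 2, 1, …, 1)` with `p ≥ 2`;
that is, `f` has exactly one fibre of size `p`, one (other) fibre of size `2`, and every
other fibre has size at most `1`.  Then `G` synchronises `f`: the semigroup of maps
`Ω → Ω` generated under composition by `G ∪ {f}` contains a constant map. -/
theorem stmt_6 {Ω : Type*} [Fintype Ω] (G : Subgroup (Equiv.Perm Ω))
    (hprim : IsPrimitiveSubgroup G)
    (f : Function.End Ω) (p : ℕ) (hp : 2 ≤ p)
    (hker : ∃ y z : Ω, y ≠ z ∧ (f ⁻¹' {y}).ncard = p ∧ (f ⁻¹' {z}).ncard = 2 ∧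
      ∀ w : Ω, w ≠ y → w ≠ z → (f ⁻¹' {w}).ncard ≤ 1) :
    ∃ k ∈ Subsemigroup.closure ({g : Function.End Ω | ∃ h ∈ G, g = ⇑h} ∪ {f}),
      ∃ c : Ω, ∀ x : Ω, k x = c := by
  obtain ⟨y, z, -, hy, hz, hw⟩ := hker
  set S := Subsemigroup.closure ({g : Function.End Ω | ∃ h ∈ G, g = ⇑h} ∪ {f}) with hS
  have hcomp : ∀ k ∈ S, ∀ l ∈ S, k * l ∈ S := fun k hk l hl => S.mul_mem hk hl
  have hGS : ∀ g ∈ G, (⇑g : Function.End Ω) ∈ S := fun g hg =>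
    Subsemigroup.subset_closure (Or.inl ⟨g, hg, rfl⟩)
  have hfS : f ∈ S := Subsemigroup.subset_closure (Or.inr rfl)
  exact hprim.exists_const (S := (S : Set (Function.End Ω))) hcomp hGS hfS (hp.trans hy.ge) hz hw
end

section
/- Let Γ be a vertex-primitive digraph on a finite set Ω with ∅ ≠ Γ ≠ Ω × Ω, regular of valency d. Let κ be the smallest positive integer i with Γ_i ≠ ∅, and let ℓ = min{ i ≥ κ : Γ_{i+1} = Γ_{i+2} = ⋯ = Γ_{i+κ} = ∅ }. Then Γ_0 ∪ Γ_1 ∪ ⋯ ∪ Γ_ℓ = Ω × Ω; in particular |Ω| = Σ_{i=0}^{ℓ} |Γ_i(α)| for every vertex α. -/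
theorem mem_GammaI_symm {Ω : Type*} {Γ : Set (Ω × Ω)} {d i : ℕ} {u v : Ω}
    (h : (u, v) ∈ GammaI Γ d i) : (v, u) ∈ GammaI Γ d i := by
  simpa only [GammaI, Set.mem_ofPred_eq, Set.inter_comm] using h

theorem nbhd_apply_of_mem_digraphAut {Ω : Type*} {Γ : Set (Ω × Ω)} {g : Equiv.Perm Ω}
    (hg : g ∈ digraphAut Γ) (u : Ω) : nbhd Γ (g u) = g '' nbhd Γ u := by
  ext x
  constructor
  · intro hx
    refine ⟨g⁻¹ x, (hg u (g⁻¹ x)).2 ?_, by simp⟩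
    simpa [nbhd] using hx
  · rintro ⟨y, hy, rfl⟩
    exact (hg u y).1 hy

theorem mem_GammaI_apply {Ω : Type*} {Γ : Set (Ω × Ω)} {d i : ℕ} {g : Equiv.Perm Ω}
    (hg : g ∈ digraphAut Γ) {u v : Ω} (h : (u, v) ∈ GammaI Γ d i) :
    (g u, g v) ∈ GammaI Γ d i := by
  simp only [GammaI, Set.mem_ofPred_eq] at h ⊢
  rwa [nbhd_apply_of_mem_digraphAut hg, nbhd_apply_of_mem_digraphAut hg,
    ← Set.image_inter g.injective, Set.ncard_image_of_injective _ g.injective]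

/-- The numbers `d - |Γ(u) ∩ Γ(v)|` satisfy the triangle inequality. -/
theorem GammaI_triangle {Ω : Type*} [Finite Ω] {Γ : Set (Ω × Ω)} {d : ℕ}
    (hreg : ∀ v : Ω, (nbhd Γ v).ncard = d) {u v w : Ω} {i j : ℕ}
    (huv : (u, v) ∈ GammaI Γ d i) (hvw : (v, w) ∈ GammaI Γ d j) :
    ∃ k ≤ i + j, (u, w) ∈ GammaI Γ d k := by
  simp only [GammaI, Set.mem_ofPred_eq] at *
  have hsub : (nbhd Γ u ∩ nbhd Γ v) ∩ (nbhd Γ v ∩ nbhd Γ w) ⊆ nbhd Γ u ∩ nbhd Γ w :=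
    fun x hx => ⟨hx.1.1, hx.2.2⟩
  have hunion : (nbhd Γ u ∩ nbhd Γ v) ∪ (nbhd Γ v ∩ nbhd Γ w) ⊆ nbhd Γ v :=
    Set.union_subset Set.inter_subset_right Set.inter_subset_left
  have h1 := Set.ncard_le_ncard hsub
  have h2 := Set.ncard_le_ncard hunion
  have h3 := Set.ncard_union_add_ncard_inter (nbhd Γ u ∩ nbhd Γ v) (nbhd Γ v ∩ nbhd Γ w)
  have h4 := Set.ncard_le_ncard (Set.inter_subset_left : nbhd Γ u ∩ nbhd Γ w ⊆ nbhd Γ u)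
  rw [hreg] at h2 h4
  exact ⟨d - (nbhd Γ u ∩ nbhd Γ w).ncard, by omega, by omega⟩

/-- A nonempty symmetric invariant relation off the diagonal of a primitive group is connected. -/
theorem IsPrimitiveSubgroup.reflTransGen {Ω : Type*} {G : Subgroup (Equiv.Perm Ω)}
    (hG : IsPrimitiveSubgroup G) {r : Ω → Ω → Prop} [Std.Symm r]
    (hinv : ∀ g ∈ G, ∀ u v, r u v → r (g u) (g v)) {a b : Ω} (hab : r a b) (hne : a ≠ b)
    (u v : Ω) : Relation.ReflTransGen r u v := by
  have hs {x y : Ω} (h : Relation.ReflTransGen r x y) : Relation.ReflTransGen r y x :=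
    Std.Symm.symm _ _ h
  let B : Set Ω := {x | Relation.ReflTransGen r a x}
  have hB : MulAction.IsBlock G B := by
    rw [MulAction.isBlock_iff_smul_eq_of_nonempty]
    rintro g ⟨x, ⟨y, hy, hyx⟩, hx⟩
    have hlift (h : G) {x y : Ω} (hxy : Relation.ReflTransGen r x y) :
        Relation.ReflTransGen r (h • x) (h • y) :=
      hxy.lift (fun z => h • z) fun _ _ hr => hinv h.1 h.2 _ _ hr
    have hga : Relation.ReflTransGen r a (g • a) := by
      have := hlift g (hs hy)
      have hyx' : g • y = x := hyx
      rw [hyx'] at this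
      exact hx.trans this
    ext z
    rw [Set.mem_smul_set_iff_inv_smul_mem]
    constructor
    · intro hz
      have := hlift g hz
      rw [smul_inv_smul] at this
      exact hga.trans this
    · intro hz
      have := hlift g⁻¹ ((hs hga).trans hz)
      rwa [inv_smul_smul] at this
  rcases hG.2 B hB with h | h
  · exact absurd (h Relation.ReflTransGen.refl (Relation.ReflTransGen.single hab)) hne
  · have hu : u ∈ B := h ▸ Set.mem_univ u
    have hv : v ∈ B := h ▸ Set.mem_univ v
    exact (hs hu).trans hv

/-- **Λ = Ω × Ω (Section 3).** With `κ` the smallest positive `i` with `Γ_i ≠ ∅` and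
`ℓ = min { i ≥ κ : Γ_{i+1} = ⋯ = Γ_{i+κ} = ∅ }`, one has `Γ_0 ∪ Γ_1 ∪ ⋯ ∪ Γ_ℓ = Ω × Ω`;
in particular `|Ω| = ∑_{i=0}^{ℓ} |Γ_i(α)|` for every vertex `α`. -/
theorem stmt_9 {Ω : Type*} [Fintype Ω] (Γ : Set (Ω × Ω))
    (hprim : VertexPrimitive Γ) (hne : Γ ≠ ∅) (hnu : Γ ≠ Set.univ)
    (d : ℕ) (hreg : ∀ v : Ω, (nbhd Γ v).ncard = d)
    (κ : ℕ) (hκpos : 0 < κ) (hκne : GammaI Γ d κ ≠ ∅)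
    (hκmin : ∀ j : ℕ, 0 < j → j < κ → GammaI Γ d j = ∅)
    (ℓ : ℕ) (hℓκ : κ ≤ ℓ)
    (hℓgap : ∀ j : ℕ, ℓ + 1 ≤ j → j ≤ ℓ + κ → GammaI Γ d j = ∅)
    (hℓmin : ∀ m : ℕ, κ ≤ m → (∀ j : ℕ, m + 1 ≤ j → j ≤ m + κ → GammaI Γ d j = ∅) →
      ℓ ≤ m) :
    (⋃ i ∈ Finset.range (ℓ + 1), GammaI Γ d i) = Set.univ ∧
      ∀ α : Ω, Fintype.card Ω = ∑ i ∈ Finset.range (ℓ + 1), (nbhd (GammaI Γ d i) α).ncard := by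
  have hball : ∀ u v : Ω, ∃ i ≤ ℓ, (u, v) ∈ GammaI Γ d i := by
    obtain ⟨⟨a, b⟩, hab⟩ := Set.nonempty_iff_ne_empty.2 hκne
    have hab_ne : a ≠ b := by
      rintro rfl
      simp only [GammaI, Set.mem_ofPred_eq, Set.inter_self, hreg] at hab
      omega
    intro u v
    have : Std.Symm fun x y => (x, y) ∈ GammaI Γ d κ := ⟨fun _ _ => mem_GammaI_symm⟩
    have huv := hprim.reflTransGen (r := fun x y => (x, y) ∈ GammaI Γ d κ)
      (fun g hg _ _ => mem_GammaI_apply hg) hab hab_ne u v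
    induction huv with
    | refl => exact ⟨0, Nat.zero_le _, by simp [GammaI, hreg]⟩
    | tail _ hvw ih =>
      obtain ⟨i, hi, huv⟩ := ih
      obtain ⟨k, hk, huw⟩ := GammaI_triangle hreg huv hvw
      refine ⟨k, ?_, huw⟩
      by_contra hlt
      rw [hℓgap k (by omega) (by omega)] at huw
      exact huw
  refine ⟨Set.eq_univ_of_forall fun ⟨u, v⟩ => ?_, fun α => ?_⟩
  · obtain ⟨i, hi, h⟩ := hball u v
    exact Set.mem_biUnion (Finset.mem_coe.2 (Finset.mem_range.2 (by omega))) h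
  · classical
    choose f hfle hf using hball α
    rw [← Finset.card_univ, Finset.card_eq_sum_card_fiberwise (f := f)
      (t := Finset.range (ℓ + 1)) fun v _ => by simpa [Nat.lt_succ_iff] using hfle v]
    refine Finset.sum_congr rfl fun i _ => ?_
    rw [← Set.ncard_coe_finset]
    congr 1
    ext v
    have h := hf v
    simp only [GammaI, nbhd, Set.mem_ofPred_eq, Finset.coe_filter, Finset.mem_univ, true_and]
      at h ⊢
    omega
end

section
/- Let n, d, κ be positive integers with 2 ≤ κ ≤ d − 1 and (n − 1)(d − κ) = d(d − 1). Then (d − κ) divides κ(κ − 1), n = d + κ + κ(κ − 1)/(d − κ), d ≤ κ², and n ≤ κ² + κ + 1. -/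
/-- **Arithmetic of Section 5 (Eqs. (11)–(13)).** If `n, d, κ` are positive integers with
`2 ≤ κ ≤ d - 1` and `(n-1)(d-κ) = d(d-1)`, then `(d-κ) ∣ κ(κ-1)`,
`n = d + κ + κ(κ-1)/(d-κ)`, `d ≤ κ²` and `n ≤ κ² + κ + 1`. -/
theorem stmt_13 (n d κ : ℕ) (hn : 0 < n) (hd : 0 < d) (hκ2 : 2 ≤ κ) (hκd : κ ≤ d - 1)
    (heq : (n - 1) * (d - κ) = d * (d - 1)) :
    (d - κ) ∣ κ * (κ - 1) ∧
    n = d + κ + κ * (κ - 1) / (d - κ) ∧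
    d ≤ κ ^ 2 ∧
    n ≤ κ ^ 2 + κ + 1 := by
  obtain ⟨e, rfl⟩ : ∃ e, d = κ + e := ⟨d - κ, by omega⟩
  obtain ⟨k, rfl⟩ : ∃ k, κ = k + 1 := ⟨κ - 1, by omega⟩
  obtain ⟨m, rfl⟩ : ∃ m, n = m + 1 := ⟨n - 1, by omega⟩
  have he : 0 < e := by omega
  have hk : 0 < k := by omega
  simp only [Nat.add_sub_cancel, Nat.add_sub_cancel_left,
    show k + 1 + e - 1 = k + e by omega] at heq ⊢
  have hdvd : e ∣ (k + 1) * k := by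
    have h : e ∣ e * (2 * k + 1 + e) + (k + 1) * k := ⟨m, by linarith⟩
    exact (Nat.dvd_add_right (dvd_mul_right e _)).mp h
  obtain ⟨q, hq⟩ := hdvd
  have hq0 : 0 < q := by
    rcases Nat.eq_zero_or_pos q with rfl | h
    · have : 0 < (k + 1) * k := by positivity
      omega
    · exact h
  have hm : m = 2 * k + 1 + e + q := by
    apply Nat.eq_of_mul_eq_mul_right he
    linarith
  refine ⟨⟨q, hq⟩, ?_, ?_, ?_⟩
  · rw [hq, Nat.mul_div_cancel_left q he]
    omega
  · nlinarith [Nat.mul_le_mul_left e hq0]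
  · obtain ⟨a, rfl⟩ := Nat.exists_eq_add_of_lt he
    obtain ⟨b, rfl⟩ := Nat.exists_eq_add_of_lt hq0
    nlinarith [Nat.zero_le (a * b)]
end
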